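/- arXiv:2005.11923 — 8 statements merged into one kernel-verified Lean document; each statement's English description precedes it below -/
import Mathlib

section
/- Let h : ℝ → ℝ be strictly convex and differentiable on [0, C], let λ ∈ ℝ^F, and let û be a minimizer of the capacitated allocation problem P(h, λ, C). Then for every index f such that λ_f ≤ h'(0), it holds that û_f = 0. -/
/-- Feasibility for the capacitated allocation problem `P(h, λ, C)`:
componentwise nonnegativity and a total budget of `C`. -/
def Feasible (F : ℕ) (C : ℝ) (u : Fin F → ℝ) : Prop :=
  (∀ f, 0 ≤ u f) ∧ ∑ f, u f ≤ C

/-- Objective of the capacitated allocation problem `P(h, λ, C)`. -/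
def Obj (F : ℕ) (h : ℝ → ℝ) (lam u : Fin F → ℝ) : ℝ :=
  ∑ f, (h (u f) - lam f * u f)

/-- `uhat` is a minimizer of the capacitated allocation problem `P(h, λ, C)`. -/
def IsMinimizerP (F : ℕ) (C : ℝ) (h : ℝ → ℝ) (lam uhat : Fin F → ℝ) : Prop :=
  Feasible F C uhat ∧ ∀ u, Feasible F C u → Obj F h lam uhat ≤ Obj F h lam u

/-- Lemma 1(a): if `h` is strictly convex and differentiable on `[0, C]` and
`û` minimizes `P(h, λ, C)`, then `λ_f ≤ h'(0)` forces `û_f = 0`. -/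
theorem lemma1a (F : ℕ) (hF : 1 ≤ F) (C : ℝ) (hC : 0 < C)
    (h h' : ℝ → ℝ)
    (hconv : StrictConvexOn ℝ (Set.Icc 0 C) h)
    (hderiv : ∀ u ∈ Set.Icc (0 : ℝ) C, HasDerivWithinAt h (h' u) (Set.Icc 0 C) u)
    (lam : Fin F → ℝ) (uhat : Fin F → ℝ)
    (hmin : IsMinimizerP F C h lam uhat)
    (f : Fin F) (hf : lam f ≤ h' 0) :
    uhat f = 0 := by
  obtain ⟨⟨hnn, hsum⟩, hm⟩ := hmin
  by_contra hne
  have hpos : 0 < uhat f := lt_of_le_of_ne (hnn f) (Ne.symm hne)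
  have hle : uhat f ≤ C :=
    (Finset.single_le_sum (fun i _ => hnn i) (Finset.mem_univ f)).trans hsum
  have h0 : (0 : ℝ) ∈ Set.Icc 0 C := ⟨le_refl _, hC.le⟩
  have hx : uhat f ∈ Set.Icc 0 C := ⟨hpos.le, hle⟩
  have hs := hconv.lt_slope_of_hasDerivWithinAt h0 hx hpos (hderiv 0 h0)
  rw [slope_def_field, sub_zero, lt_div_iff₀ hpos] at hs
  have hup : ∀ i, Function.update uhat f 0 i ≤ uhat i := by
    intro i
    by_cases hi : i = f
    · subst hi; simpa using hpos.le
    · simp [Function.update_of_ne hi]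
  have hfeas : Feasible F C (Function.update uhat f 0) := by
    refine ⟨fun i => ?_, (Finset.sum_le_sum fun i _ => hup i).trans hsum⟩
    by_cases hi : i = f
    · subst hi; simp
    · simpa [Function.update_of_ne hi] using hnn i
  have hlt : Obj F h lam (Function.update uhat f 0) < Obj F h lam uhat := by
    unfold Obj
    have key : h 0 < h (uhat f) - lam f * uhat f := by
      nlinarith [mul_le_mul_of_nonneg_right hf hpos.le]
    refine Finset.sum_lt_sum (fun i _ => ?_) ⟨f, Finset.mem_univ f, by simpa using key⟩
    by_cases hi : i = f
    · subst hi; simpa using key.le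
    · simp [Function.update_of_ne hi]
  exact absurd (hm _ hfeas) (not_le.mpr hlt)
end

section
/- Let γ_1, …, γ_F : ℝ → ℝ be strictly convex functions and let C > 0. Suppose ũ ∈ ℝ^F minimizes ∑_{f=1}^F γ_f(u_f) over {u ∈ ℝ^F : u_f ≥ 0 for all f} and satisfies ∑_{f=1}^F ũ_f > C. Then every minimizer û of ∑_{f=1}^F γ_f(u_f) over {u ∈ ℝ^F : u_f ≥ 0 for all f, ∑_{f=1}^F u_f ≤ C} satisfies ∑_{f=1}^F û_f = C, i.e., the capacity constraint is active. -/
/-- Core convexity argument of Lemma 1(b): if the nonnegativity-constrained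
minimizer `ũ` of a separable strictly convex objective has total mass exceeding
the budget `C`, then any minimizer `û` of the budget-constrained problem
saturates the budget: `∑ û_f = C`. -/
theorem lemma1b (F : ℕ) (hF : 1 ≤ F) (C : ℝ) (hC : 0 < C)
    (γ : Fin F → ℝ → ℝ)
    (hconv : ∀ f, StrictConvexOn ℝ Set.univ (γ f))
    (utilde : Fin F → ℝ)
    (htilde_nonneg : ∀ f, 0 ≤ utilde f)
    (htilde_min : ∀ u : Fin F → ℝ, (∀ f, 0 ≤ u f) →
      ∑ f, γ f (utilde f) ≤ ∑ f, γ f (u f))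
    (htilde_over : C < ∑ f, utilde f)
    (uhat : Fin F → ℝ)
    (hhat_nonneg : ∀ f, 0 ≤ uhat f)
    (hhat_budget : ∑ f, uhat f ≤ C)
    (hhat_min : ∀ u : Fin F → ℝ, (∀ f, 0 ≤ u f) → ∑ f, u f ≤ C →
      ∑ f, γ f (uhat f) ≤ ∑ f, γ f (u f)) :
    ∑ f, uhat f = C := by
  by_contra hne
  have hlt : ∑ f, uhat f < C := lt_of_le_of_ne hhat_budget hne
  have hST : ∑ f, uhat f < ∑ f, utilde f := hlt.trans htilde_over
  obtain ⟨g, -, hg⟩ := Finset.exists_lt_of_sum_lt hST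
  have hd : 0 < ∑ f, utilde f - ∑ f, uhat f := by linarith
  obtain ⟨t, ht⟩ : ∃ t, t = (C - ∑ f, uhat f) / (∑ f, utilde f - ∑ f, uhat f) := ⟨_, rfl⟩
  have ht0 : 0 < t := by rw [ht]; exact div_pos (by linarith) hd
  have ht1 : t < 1 := by rw [ht, div_lt_one hd]; linarith
  have htm : t * (∑ f, utilde f - ∑ f, uhat f) = C - ∑ f, uhat f := by
    rw [ht]; exact div_mul_cancel₀ _ hd.ne'
  have hs0 : 0 < 1 - t := by linarith
  have h1 := hhat_min (fun f => (1 - t) * uhat f + t * utilde f)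
    (fun f => add_nonneg (mul_nonneg hs0.le (hhat_nonneg f))
      (mul_nonneg ht0.le (htilde_nonneg f)))
    (by
      rw [Finset.sum_add_distrib, ← Finset.mul_sum, ← Finset.mul_sum]
      linarith)
  have h2 : ∑ f, γ f ((1 - t) * uhat f + t * utilde f) <
      ∑ f, ((1 - t) * γ f (uhat f) + t * γ f (utilde f)) := by
    apply Finset.sum_lt_sum
    · intro f _
      exact (hconv f).convexOn.2 (Set.mem_univ _) (Set.mem_univ _) hs0.le ht0.le (by ring)
    · exact ⟨g, Finset.mem_univ _,
        (hconv g).2 (Set.mem_univ _) (Set.mem_univ _) hg.ne hs0 ht0 (by ring)⟩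
  rw [Finset.sum_add_distrib, ← Finset.mul_sum, ← Finset.mul_sum] at h2
  have h3 := mul_le_mul_of_nonneg_left (htilde_min uhat hhat_nonneg) ht0.le
  linarith
end

section
/- Let h : ℝ → ℝ be strictly convex and differentiable on [0, ∞), let λ ∈ ℝ^F and C > 0. For υ ≥ 0 and each f, let w_f(υ) denote the (unique) minimizer of u ↦ h(u) − (λ_f − υ)u over {u ≥ 0}, assumed to exist. Suppose ∑_{f=1}^F w_f(0) > C and that υ̂ ≥ 0 satisfies ∑_{f=1}^F w_f(υ̂) = C. Then (w_1(υ̂), …, w_F(υ̂)) is the unique minimizer of the capacitated allocation problem P(h, λ, C), and moreover 0 < υ̂ < max_f λ_f − h'(0). -/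
/-- `w` is the unique minimizer of `g` over the nonnegative reals. -/
def IsUniqueMinNonneg (g : ℝ → ℝ) (w : ℝ) : Prop :=
  0 ≤ w ∧ ∀ u, 0 ≤ u → u ≠ w → g w < g u

/-- Second case of Lemma 1(c): if the componentwise nonnegativity-constrained
minimizers at multiplier `0` jointly violate the budget, and `υ̂ ≥ 0` is such
that the componentwise minimizers for the tilted prices `λ_f − υ̂` exactly meet
the budget, then they form the unique minimizer of `P(h, λ, C)`, and
`0 < υ̂ < max_f λ_f − h'(0)`. -/
theorem lemma1c_case2 (F : ℕ) (hF : 1 ≤ F) (C : ℝ) (hC : 0 < C)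
    (h h' : ℝ → ℝ)
    (hconv : StrictConvexOn ℝ (Set.Ici 0) h)
    (hderiv : ∀ u ∈ Set.Ici (0 : ℝ), HasDerivWithinAt h (h' u) (Set.Ici 0) u)
    (lam : Fin F → ℝ) (w : ℝ → Fin F → ℝ)
    (hw : ∀ υ : ℝ, 0 ≤ υ → ∀ f,
      IsUniqueMinNonneg (fun u => h u - (lam f - υ) * u) (w υ f))
    (hover : C < ∑ f, w 0 f)
    (υhat : ℝ) (hυ_nonneg : 0 ≤ υhat) (hυ_eq : ∑ f, w υhat f = C) :
    (Feasible F C (w υhat) ∧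
      ∀ u : Fin F → ℝ, Feasible F C u → u ≠ w υhat →
        Obj F h lam (w υhat) < Obj F h lam u) ∧
    0 < υhat ∧
    υhat < Finset.univ.sup' ⟨(⟨0, hF⟩ : Fin F), Finset.mem_univ _⟩ lam - h' 0 := by
  have key := hw υhat hυ_nonneg
  refine ⟨⟨⟨fun f => (key f).1, hυ_eq.le⟩, ?_⟩, ?_, ?_⟩
  · intro u hu hne
    obtain ⟨g, hg⟩ := Function.ne_iff.mp hne
    have hlt : ∑ f, (h (w υhat f) - (lam f - υhat) * w υhat f)
        < ∑ f, (h (u f) - (lam f - υhat) * u f) := by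
      refine Finset.sum_lt_sum (fun f _ => ?_)
        ⟨g, Finset.mem_univ _, (key g).2 (u g) (hu.1 g) hg⟩
      by_cases e : u f = w υhat f
      · rw [e]
      · exact ((key f).2 (u f) (hu.1 f) e).le
    have expand : ∀ v : Fin F → ℝ, ∑ f, (h (v f) - (lam f - υhat) * v f)
        = Obj F h lam v + υhat * ∑ f, v f := by
      intro v
      rw [Obj, Finset.mul_sum, ← Finset.sum_add_distrib]
      exact Finset.sum_congr rfl fun f _ => by ring
    rw [expand, expand, hυ_eq] at hlt
    have := mul_le_mul_of_nonneg_left hu.2 hυ_nonneg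
    linarith
  · rcases hυ_nonneg.lt_or_eq with hlt | heq
    · exact hlt
    · rw [← heq] at hυ_eq
      linarith
  · obtain ⟨f, -, hf⟩ : ∃ f ∈ Finset.univ, 0 < w υhat f := by
      apply Finset.exists_lt_of_sum_lt (f := fun _ => (0 : ℝ))
      simpa [hυ_eq] using hC
    have h1 := (key f).2 0 le_rfl hf.ne
    have h2 := hconv.convexOn.le_slope_of_hasDerivWithinAt (Set.mem_Ici.2 le_rfl)
      (Set.mem_Ici.2 hf.le) hf (hderiv 0 (Set.mem_Ici.2 le_rfl))
    rw [slope_def_field, le_div_iff₀ (by linarith)] at h2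
    have h3 : h' 0 < lam f - υhat := by
      simp only [mul_zero, sub_zero] at h1 h2
      exact lt_of_mul_lt_mul_right (by linarith) hf.le
    have h4 := Finset.le_sup' lam (Finset.mem_univ f)
    linarith
end

section
/- Let h : ℝ → ℝ be strictly convex and differentiable on [0, C], let λ ∈ ℝ^F, C > 0, and let û be the minimizer of the capacitated allocation problem P(h, λ, C). Then for every f, h'(û_f) ≤ max{λ_f, h'(0)}. In particular, whenever λ_f ≥ h'(0) it holds that h'(û_f) ≤ λ_f. -/
/-- Inequality (lamineq) in the proof of Lemma 2: at the minimizer `û` of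
`P(h, λ, C)`, the marginal cost never exceeds `max{λ_f, h'(0)}`; in particular
`h'(û_f) ≤ λ_f` whenever `λ_f ≥ h'(0)`. -/
theorem marginal_cost_bound (F : ℕ) (hF : 1 ≤ F) (C : ℝ) (hC : 0 < C)
    (h h' : ℝ → ℝ)
    (hconv : StrictConvexOn ℝ (Set.Icc 0 C) h)
    (hderiv : ∀ u ∈ Set.Icc (0 : ℝ) C, HasDerivWithinAt h (h' u) (Set.Icc 0 C) u)
    (lam : Fin F → ℝ) (uhat : Fin F → ℝ)
    (hfeas : Feasible F C uhat)
    (hmin : ∀ u : Fin F → ℝ, Feasible F C u → Obj F h lam uhat ≤ Obj F h lam u) :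
    (∀ f, h' (uhat f) ≤ max (lam f) (h' 0)) ∧
    (∀ f, h' 0 ≤ lam f → h' (uhat f) ≤ lam f) := by
  have key : ∀ f, h' (uhat f) ≤ max (lam f) (h' 0) := by
    intro f
    obtain ⟨hnn, hsum⟩ := hfeas
    rcases (hnn f).eq_or_lt with h0 | hpos
    · rw [← h0]; exact le_max_right _ _
    refine le_trans ?_ (le_max_left _ _)
    have haC : uhat f ≤ C :=
      (Finset.single_le_sum (fun i _ => hnn i) (Finset.mem_univ f)).trans hsum
    have hcmp : ∀ t, 0 ≤ t → t < uhat f →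
        h (uhat f) - lam f * uhat f ≤ h t - lam f * t := by
      intro t ht hta
      have hle : ∀ i, Function.update uhat f t i ≤ uhat i := by
        intro i
        by_cases hi : i = f
        · subst hi; simpa using hta.le
        · simp [hi]
      have hm := hmin (Function.update uhat f t) ⟨by
        intro i
        by_cases hi : i = f
        · subst hi; simpa using ht
        · simpa [hi] using hnn i, (Finset.sum_le_sum fun i _ => hle i).trans hsum⟩
      unfold Obj at hm
      rw [← Finset.add_sum_erase _ _ (Finset.mem_univ f),
        ← Finset.add_sum_erase _ (fun i => h (Function.update uhat f t i) -
          lam i * Function.update uhat f t i) (Finset.mem_univ f)] at hm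
      have he : ∑ i ∈ Finset.univ.erase f, (h (Function.update uhat f t i) -
          lam i * Function.update uhat f t i) =
          ∑ i ∈ Finset.univ.erase f, (h (uhat i) - lam i * uhat i) := by
        refine Finset.sum_congr rfl fun i hi => ?_
        rw [Function.update_of_ne (Finset.ne_of_mem_erase hi)]
      rw [he] at hm
      simp only [Function.update_self] at hm
      linarith
    have hd : HasDerivWithinAt h (h' (uhat f)) (Set.Ico 0 (uhat f)) (uhat f) :=
      (hderiv _ ⟨hnn f, haC⟩).mono fun x hx => ⟨hx.1, hx.2.le.trans haC⟩
    rw [hasDerivWithinAt_iff_tendsto_slope' (by simp)] at hd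
    have hne : (nhdsWithin (uhat f) (Set.Ico 0 (uhat f))).NeBot := by
      rw [← mem_closure_iff_nhdsWithin_neBot, closure_Ico hpos.ne]
      exact ⟨hpos.le, le_rfl⟩
    refine le_of_tendsto hd ?_
    filter_upwards [self_mem_nhdsWithin] with t ht
    have := hcmp t ht.1 ht.2
    rw [slope_def_field, div_le_iff_of_neg (by linarith [ht.2])]
    linarith
  exact ⟨key, fun f hf => (key f).trans (max_le le_rfl hf)⟩
end

section
/- Let h : ℝ → ℝ be differentiable on [0, ∞) and suppose there exist constants 0 < m ≤ L such that m(x₁ − x₂) ≤ h'(x₁) − h'(x₂) ≤ L(x₁ − x₂) for all 0 ≤ x₂ ≤ x₁. Let λ ∈ ℝ and let w be a minimizer of u ↦ h(u) − λu over {u ≥ 0}. Then (λ − h'(0))/L ≤ w ≤ [λ − h'(0)]_+/m, where [z]_+ = max{z, 0}. -/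
/-- Two-sided bound on the one-dimensional nonnegativity-constrained minimizer
of `u ↦ h(u) − λu` in terms of the strong convexity modulus `m` and the
gradient Lipschitz constant `L` of `h`:
`(λ − h'(0))/L ≤ w ≤ [λ − h'(0)]_+ / m`. -/
theorem one_dim_minimizer_bounds (h h' : ℝ → ℝ)
    (hderiv : ∀ x ∈ Set.Ici (0 : ℝ), HasDerivWithinAt h (h' x) (Set.Ici 0) x)
    (m L : ℝ) (hm : 0 < m) (hmL : m ≤ L)
    (hincr : ∀ x₁ x₂ : ℝ, 0 ≤ x₂ → x₂ ≤ x₁ →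
      m * (x₁ - x₂) ≤ h' x₁ - h' x₂ ∧ h' x₁ - h' x₂ ≤ L * (x₁ - x₂))
    (lam : ℝ) (w : ℝ)
    (hw_nonneg : 0 ≤ w)
    (hw_min : ∀ u : ℝ, 0 ≤ u → h w - lam * w ≤ h u - lam * u) :
    (lam - h' 0) / L ≤ w ∧ w ≤ max (lam - h' 0) 0 / m := by
  have hL : 0 < L := lt_of_lt_of_le hm hmL
  have hd : HasDerivWithinAt (fun u => h u - lam * u) (h' w - lam) (Set.Ici 0) w := by
    have h2 := (hderiv w hw_nonneg).sub ((hasDerivWithinAt_id w (Set.Ici 0)).const_mul lam)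
    rw [mul_one] at h2
    exact h2
  have hmin : IsLocalMinOn (fun u => h u - lam * u) (Set.Ici 0) w :=
    IsMinOn.localize (fun u hu => hw_min u hu)
  have key : ∀ y : ℝ, 0 ≤ y → 0 ≤ (y - w) * (h' w - lam) := by
    intro y hy
    have hc : y - w ∈ posTangentConeAt (Set.Ici (0 : ℝ)) w :=
      sub_mem_posTangentConeAt_of_segment_subset
        ((convex_Ici (0 : ℝ)).segment_subset hw_nonneg hy)
    have h3 := hmin.hasFDerivWithinAt_nonneg hd.hasFDerivWithinAt hc
    simpa using h3
  have k1 := key (w + 1) (by linarith)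
  have k2 := key 0 le_rfl
  obtain ⟨i1, i2⟩ := hincr w 0 le_rfl hw_nonneg
  constructor
  · rw [div_le_iff₀ hL]
    nlinarith
  · rw [le_div_iff₀ hm]
    rcases hw_nonneg.eq_or_lt with h0 | h0
    · rw [← h0]; simp
    · have : h' w ≤ lam := by
        by_contra hcon
        push Not at hcon
        nlinarith
      exact le_trans (by linarith) (le_max_left _ _)
end

section
/- Fix F ≥ 1, capacities C_c > 0 and C_r > 0, and differentiable functions χ, φ : ℝ → ℝ satisfying: m_χ(x₁ − x₂) ≤ χ'(x₁) − χ'(x₂) ≤ L_χ(x₁ − x₂) for all 0 ≤ x₂ ≤ x₁ ≤ C_c, and m_φ(y₁ − y₂) ≤ φ'(y₁) − φ'(y₂) ≤ L_φ(y₁ − y₂) for all 0 ≤ y₂ ≤ y₁ ≤ C_r, with m_χ, m_φ, L_χ, L_φ > 0. Let demands d_f(t) ≥ 0 satisfy ∑_{f=1}^F d_f(t) ≤ C_c + C_r for every t ≥ 0. Define φ₀ = min{χ'(0), φ'(0)}, ψ = max{χ'(0), φ'(0)}, L = max{L_χ, L_φ}, and Δ = L(C_c + C_r) + Fψ. Consider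 the iteration: given λ(t) ∈ ℝ^F, let x̂(t) be the minimizer of ∑_f (χ(x_f) − λ_f(t) x_f) over {x ∈ ℝ^F : x_f ≥ 0, ∑_f x_f ≤ C_c}, let ŷ(t) be the minimizer of ∑_f (φ(y_f) − λ_f(t) y_f) over {y ∈ ℝ^F : y_f ≥ 0, ∑_f y_f ≤ C_r}, and set λ_f(t+1) = λ_f(t) − μ(x̂_f(t) + ŷ_f(t) − d_f(t)). If the step size satisfies 0 < μ ≤ m_χ m_φ/(m_χ + m_φ) and the initialization satisfies λ_f(0) ≥ φ₀ for all f and ∑_{f=1}^F λ_f(0) ≤ Δ, then for every t ≥ 1: λ_f(t) ≥ φ₀ for all f, and ∑_{f=1}^F λ_f(t) ≤ Δ. -/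
/-- First-order condition in one variable. -/
lemma foc_one {C a b h' : ℝ} {h : ℝ → ℝ} (ha : a ∈ Set.Icc 0 C) (hb : b ∈ Set.Icc 0 C)
    (hd : HasDerivWithinAt h h' (Set.Icc 0 C) a)
    (hmin : ∀ s ∈ segment ℝ a b, h a ≤ h s) : 0 ≤ (b - a) * h' := by
  have hsub : segment ℝ a b ⊆ Set.Icc 0 C := (convex_Icc 0 C).segment_subset ha hb
  have hd2 := (hd.mono hsub).hasFDerivWithinAt
  have hm : IsLocalMinOn h (segment ℝ a b) a :=
    Filter.eventually_of_mem self_mem_nhdsWithin hmin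
  have := hm.hasFDerivWithinAt_nonneg hd2
    (sub_mem_posTangentConeAt_of_segment_subset (subset_refl (segment ℝ a b)))
  simpa using this

lemma foc_coord {F : ℕ} {C : ℝ} {g g' : ℝ → ℝ}
    (hderiv : ∀ x ∈ Set.Icc (0 : ℝ) C, HasDerivWithinAt g (g' x) (Set.Icc 0 C) x)
    {l z : Fin F → ℝ} (hz0 : ∀ f, 0 ≤ z f) (hzC : ∑ f, z f ≤ C)
    (hmin : ∀ x : Fin F → ℝ, (∀ f, 0 ≤ x f) → ∑ f, x f ≤ C →
        ∑ f, (g (z f) - l f * z f) ≤ ∑ f, (g (x f) - l f * x f))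
    (f : Fin F) {b : ℝ} (hb0 : 0 ≤ b) (hbC : ∑ f, z f + (b - z f) ≤ C) :
    0 ≤ (b - z f) * (g' (z f) - l f) := by
  have hle : z f ≤ ∑ f, z f := Finset.single_le_sum (fun i _ => hz0 i) (Finset.mem_univ f)
  have ha : z f ∈ Set.Icc 0 C := ⟨hz0 f, by linarith⟩
  have hb : b ∈ Set.Icc 0 C := ⟨hb0, by linarith⟩
  refine foc_one (h := fun s => g s - l f * s) ha hb ?_ ?_
  · have h1 := (hderiv _ ha).sub ((hasDerivWithinAt_id (z f) (Set.Icc 0 C)).const_mul (l f))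
    rw [mul_one] at h1
    exact h1
  · intro s hs
    have key : ∀ k : Fin F → ℝ → ℝ, ∑ i, k i (Function.update z f s i)
        = ∑ i, k i (z i) + (k f s - k f (z f)) := by
      intro k
      rw [← Finset.add_sum_erase _ (fun i => k i (Function.update z f s i)) (Finset.mem_univ f),
        ← Finset.add_sum_erase _ (fun i => k i (z i)) (Finset.mem_univ f)]
      have : ∑ i ∈ Finset.univ.erase f, k i (Function.update z f s i)
          = ∑ i ∈ Finset.univ.erase f, k i (z i) := by
        refine Finset.sum_congr rfl fun i hi => ?_
        rw [Function.update_of_ne (Finset.ne_of_mem_erase hi)]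
      rw [this, Function.update_self]
      ring
    have hs2 : 0 ≤ s ∧ ∑ f, z f + (s - z f) ≤ C := by
      have := segment_subset_uIcc (z f) b hs
      rw [Set.mem_uIcc] at this
      have := hz0 f
      rcases ‹_ ∨ _› with h | h <;> constructor <;> linarith [h.1, h.2]
    have h1 := hmin (Function.update z f s) (by
      intro i
      by_cases hi : i = f
      · subst hi; simpa using hs2.1
      · rw [Function.update_of_ne hi]; exact hz0 i) (by
      rw [key (fun _ x => x)]; exact hs2.2)
    rw [key (fun i x => g x - l i * x)] at h1
    linarith

lemma foc_lower {F : ℕ} {C : ℝ} {g g' : ℝ → ℝ} {m L c : ℝ}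
    (hderiv : ∀ x ∈ Set.Icc (0 : ℝ) C, HasDerivWithinAt g (g' x) (Set.Icc 0 C) x)
    (hincr : ∀ x₁ x₂ : ℝ, 0 ≤ x₂ → x₂ ≤ x₁ → x₁ ≤ C →
      m * (x₁ - x₂) ≤ g' x₁ - g' x₂ ∧ g' x₁ - g' x₂ ≤ L * (x₁ - x₂))
    {l z : Fin F → ℝ} (hz0 : ∀ f, 0 ≤ z f) (hzC : ∑ f, z f ≤ C)
    (hmin : ∀ x : Fin F → ℝ, (∀ f, 0 ≤ x f) → ∑ f, x f ≤ C →
        ∑ f, (g (z f) - l f * z f) ≤ ∑ f, (g (x f) - l f * x f))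
    (f : Fin F) (hc : c ≤ g' 0) (hl : c ≤ l f) : m * z f ≤ l f - c := by
  have hle : z f ≤ ∑ f, z f := Finset.single_le_sum (fun i _ => hz0 i) (Finset.mem_univ f)
  rcases (hz0 f).eq_or_lt with h | h
  · rw [← h]; linarith
  · have h1 := foc_coord hderiv hz0 hzC hmin f le_rfl (by linarith)
    have h2 : g' (z f) - l f ≤ 0 := by
      by_contra hn
      push Not at hn
      nlinarith [mul_pos h hn]
    have h3 := (hincr (z f) 0 le_rfl h.le (by linarith)).1
    linarith

lemma foc_upper {F : ℕ} {C : ℝ} {g g' : ℝ → ℝ} {m L : ℝ}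
    (hderiv : ∀ x ∈ Set.Icc (0 : ℝ) C, HasDerivWithinAt g (g' x) (Set.Icc 0 C) x)
    (hincr : ∀ x₁ x₂ : ℝ, 0 ≤ x₂ → x₂ ≤ x₁ → x₁ ≤ C →
      m * (x₁ - x₂) ≤ g' x₁ - g' x₂ ∧ g' x₁ - g' x₂ ≤ L * (x₁ - x₂))
    {l z : Fin F → ℝ} (hz0 : ∀ f, 0 ≤ z f) (hzC : ∑ f, z f < C)
    (hmin : ∀ x : Fin F → ℝ, (∀ f, 0 ≤ x f) → ∑ f, x f ≤ C →
        ∑ f, (g (z f) - l f * z f) ≤ ∑ f, (g (x f) - l f * x f)) :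
    ∑ f, l f ≤ F * g' 0 + L * ∑ f, z f := by
  have : ∀ f, l f ≤ g' 0 + L * z f := by
    intro f
    have hle : z f ≤ ∑ f, z f := Finset.single_le_sum (fun i _ => hz0 i) (Finset.mem_univ f)
    have h1 := foc_coord hderiv hz0 hzC.le hmin f (b := z f + (C - ∑ f, z f))
      (by linarith [hz0 f]) (by linarith)
    have h2 : 0 ≤ g' (z f) - l f := by
      refine nonneg_of_mul_nonneg_right h1 (by linarith)
    have h3 := (hincr (z f) 0 le_rfl (hz0 f) (by linarith)).2
    linarith
  calc ∑ f, l f ≤ ∑ f, (g' 0 + L * z f) := Finset.sum_le_sum fun f _ => this f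
    _ = _ := by simp [Finset.sum_add_distrib, Finset.mul_sum]


/-- Lemma 2 of the paper (single cache server): under over-provisioned demands,
two-sided increment bounds on the derivatives of the costs, a small enough step
size, and suitable initialization, the dual iterates of the incremental dual
ascent algorithm satisfy `λ_f(t) ≥ min{χ'(0), φ'(0)}` componentwise and
`∑_f λ_f(t) ≤ Δ` for all `t ≥ 1`. -/
theorem dual_iterates_bounded (F : ℕ) (hF : 1 ≤ F)
    (Cc Cr : ℝ) (hCc : 0 < Cc) (hCr : 0 < Cr)
    (χ χ' φ φ' : ℝ → ℝ)
    (hχderiv : ∀ x ∈ Set.Icc (0 : ℝ) Cc, HasDerivWithinAt χ (χ' x) (Set.Icc 0 Cc) x)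
    (hφderiv : ∀ y ∈ Set.Icc (0 : ℝ) Cr, HasDerivWithinAt φ (φ' y) (Set.Icc 0 Cr) y)
    (mχ Lχ mφ Lφ : ℝ) (hmχ : 0 < mχ) (hLχ : 0 < Lχ) (hmφ : 0 < mφ) (hLφ : 0 < Lφ)
    (hχincr : ∀ x₁ x₂ : ℝ, 0 ≤ x₂ → x₂ ≤ x₁ → x₁ ≤ Cc →
      mχ * (x₁ - x₂) ≤ χ' x₁ - χ' x₂ ∧ χ' x₁ - χ' x₂ ≤ Lχ * (x₁ - x₂))
    (hφincr : ∀ y₁ y₂ : ℝ, 0 ≤ y₂ → y₂ ≤ y₁ → y₁ ≤ Cr →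
      mφ * (y₁ - y₂) ≤ φ' y₁ - φ' y₂ ∧ φ' y₁ - φ' y₂ ≤ Lφ * (y₁ - y₂))
    (d : ℕ → Fin F → ℝ)
    (hd_nonneg : ∀ t f, 0 ≤ d t f)
    (hd_cap : ∀ t, ∑ f, d t f ≤ Cc + Cr)
    (lam : ℕ → Fin F → ℝ) (xhat yhat : ℕ → Fin F → ℝ)
    (hx : ∀ t, (∀ f, 0 ≤ xhat t f) ∧ ∑ f, xhat t f ≤ Cc ∧
      ∀ x : Fin F → ℝ, (∀ f, 0 ≤ x f) → ∑ f, x f ≤ Cc →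
        ∑ f, (χ (xhat t f) - lam t f * xhat t f) ≤ ∑ f, (χ (x f) - lam t f * x f))
    (hy : ∀ t, (∀ f, 0 ≤ yhat t f) ∧ ∑ f, yhat t f ≤ Cr ∧
      ∀ y : Fin F → ℝ, (∀ f, 0 ≤ y f) → ∑ f, y f ≤ Cr →
        ∑ f, (φ (yhat t f) - lam t f * yhat t f) ≤ ∑ f, (φ (y f) - lam t f * y f))
    (μ : ℝ) (hμ_pos : 0 < μ) (hμ_le : μ ≤ mχ * mφ / (mχ + mφ))
    (hupdate : ∀ t f, lam (t + 1) f = lam t f - μ * (xhat t f + yhat t f - d t f))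
    (hinit_lo : ∀ f, min (χ' 0) (φ' 0) ≤ lam 0 f)
    (hinit_hi : ∑ f, lam 0 f ≤
      max Lχ Lφ * (Cc + Cr) + (F : ℝ) * max (χ' 0) (φ' 0)) :
    ∀ t : ℕ, 1 ≤ t →
      (∀ f, min (χ' 0) (φ' 0) ≤ lam t f) ∧
      ∑ f, lam t f ≤ max Lχ Lφ * (Cc + Cr) + (F : ℝ) * max (χ' 0) (φ' 0) := by
  have hμχ : μ ≤ mχ := hμ_le.trans (by
    rw [div_le_iff₀ (by linarith)]; nlinarith)
  have hmLχ : mχ ≤ Lχ := by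
    have := hχincr Cc 0 le_rfl hCc.le le_rfl
    exact le_of_mul_le_mul_right (by linarith [this.1, this.2]) (show 0 < Cc - 0 by linarith)
  have hμL : μ ≤ max Lχ Lφ := (hμχ.trans hmLχ).trans (le_max_left _ _)
  have hL0 : 0 < max Lχ Lφ := lt_max_of_lt_left hLχ
  have hμ2 : μ * (mχ + mφ) ≤ mχ * mφ := (le_div_iff₀ (by linarith)).1 hμ_le
  have main : ∀ t : ℕ, (∀ f, min (χ' 0) (φ' 0) ≤ lam t f) ∧
      ∑ f, lam t f ≤ max Lχ Lφ * (Cc + Cr) + (F : ℝ) * max (χ' 0) (φ' 0) := by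
    intro t
    induction t with
    | zero => exact ⟨hinit_lo, hinit_hi⟩
    | succ t ih =>
      obtain ⟨ih1, ih2⟩ := ih
      obtain ⟨hx0, hxC, hxm⟩ := hx t
      obtain ⟨hy0, hyC, hym⟩ := hy t
      constructor
      · intro f
        have h1 := foc_lower hχderiv hχincr hx0 hxC hxm f (min_le_left _ (φ' 0)) (ih1 f)
        have h2 := foc_lower hφderiv hφincr hy0 hyC hym f (min_le_right (χ' 0) _) (ih1 f)
        have h0 := ih1 f
        rw [hupdate]
        set c := min (χ' 0) (φ' 0)
        have hd := mul_nonneg hμ_pos.le (hd_nonneg t f)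
        have h3 : mχ * mφ * (xhat t f + yhat t f) ≤ (mχ + mφ) * (lam t f - c) := by
          nlinarith [mul_le_mul_of_nonneg_left h1 hmφ.le, mul_le_mul_of_nonneg_left h2 hmχ.le]
        have h4 : μ * (xhat t f + yhat t f) ≤ lam t f - c := by
          have hp : 0 < mχ * mφ := mul_pos hmχ hmφ
          refine le_of_mul_le_mul_left ?_ hp
          calc mχ * mφ * (μ * (xhat t f + yhat t f))
              = μ * (mχ * mφ * (xhat t f + yhat t f)) := by ring
            _ ≤ μ * ((mχ + mφ) * (lam t f - c)) := mul_le_mul_of_nonneg_left h3 hμ_pos.le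
            _ = μ * (mχ + mφ) * (lam t f - c) := by ring
            _ ≤ mχ * mφ * (lam t f - c) := mul_le_mul_of_nonneg_right hμ2 (by linarith)
        linarith
      · have hS : ∑ f, lam (t + 1) f
            = ∑ f, lam t f - μ * (∑ f, xhat t f + ∑ f, yhat t f - ∑ f, d t f) := by
          simp only [hupdate, Finset.sum_sub_distrib, ← Finset.mul_sum, Finset.sum_add_distrib]
        rw [hS]
        have hX0 : 0 ≤ ∑ f, xhat t f := Finset.sum_nonneg fun f _ => hx0 f
        have hY0 : 0 ≤ ∑ f, yhat t f := Finset.sum_nonneg fun f _ => hy0 f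
        have hD := mul_le_mul_of_nonneg_left (hd_cap t) hμ_pos.le
        have hFn : (0 : ℝ) ≤ F := Nat.cast_nonneg F
        have hgap : μ * (Cc + Cr - ∑ f, xhat t f - ∑ f, yhat t f)
            ≤ max Lχ Lφ * (Cc + Cr - ∑ f, xhat t f - ∑ f, yhat t f) :=
          mul_le_mul_of_nonneg_right hμL (by linarith)
        have hLX := mul_nonneg hL0.le hX0
        have hLY := mul_nonneg hL0.le hY0
        rcases hxC.lt_or_eq with hlt | heq
        · have h := foc_upper hχderiv hχincr hx0 hlt hxm
          have ha := mul_le_mul_of_nonneg_left (le_max_left (χ' 0) (φ' 0)) hFn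
          have hb := mul_le_mul_of_nonneg_right (le_max_left Lχ Lφ) hX0
          linarith
        · rcases hyC.lt_or_eq with hlt | heq2
          · have h := foc_upper hφderiv hφincr hy0 hlt hym
            have ha := mul_le_mul_of_nonneg_left (le_max_right (χ' 0) (φ' 0)) hFn
            have hb := mul_le_mul_of_nonneg_right (le_max_right Lχ Lφ) hY0
            linarith
          · rw [heq, heq2]
            linarith
  exact fun t _ => main t
end

section
/- Under the setup of the dual ascent iteration (F ≥ 1; capacities C_c, C_r > 0; χ, φ differentiable with the two-sided increment bounds with constants m_χ, L_χ on [0, C_c] and m_φ, L_φ on [0, C_r]; demands d_f(t) ≥ 0 with ∑_f d_f(t) ≤ C_c + C_r; step size 0 < μ ≤ m_χ m_φ/(m_χ + m_φ); initialization λ_f(0) ≥ min{χ'(0), φ'(0)} for all f and ∑_f λ_f(0) ≤ Δ, where Δ = max{L_χ, L_φ}(C_c + C_r) + F·max{χ'(0), φ'(0)}; x̂(t), ŷ(t) the subproblem minimizers; λ_f(t+1) = λ_f(t) − μ(x̂_f(t) + ŷ_f(t) − d_f(t))), assume additionally that χ'(0) ≥ 0 and φ'(0) ≥ 0. Then for every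 f and every horizon T ≥ 1, the averaged demand-balance violation satisfies |(1/T) ∑_{t=0}^{T−1} (x̂_f(t) + ŷ_f(t) − d_f(t))| ≤ Δ/(μT). -/
open Filter Topology in
lemma aux_left (g : ℝ → ℝ) (g' l a C : ℝ) (ha : 0 < a) (haC : a ≤ C)
    (h : HasDerivWithinAt g g' (Set.Icc 0 C) a)
    (hmin : ∀ z, 0 ≤ z → z < a → g a - l * a ≤ g z - l * z) : g' ≤ l := by
  have h1 : HasDerivWithinAt g g' (Set.Ioo 0 a) a :=
    h.mono (fun z hz => ⟨hz.1.le, hz.2.le.trans haC⟩)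
  rw [hasDerivWithinAt_iff_tendsto_slope' (by simp)] at h1
  haveI : (𝓝[Set.Ioo 0 a] a).NeBot := by
    rw [← mem_closure_iff_nhdsWithin_neBot, closure_Ioo ha.ne]
    exact ⟨ha.le, le_rfl⟩
  refine le_of_tendsto h1 ?_
  filter_upwards [self_mem_nhdsWithin] with z hz
  rw [slope_def_field, div_le_iff_of_neg (by linarith [hz.2])]
  have := hmin z hz.1.le hz.2
  nlinarith

open Filter Topology in
lemma aux_right (g : ℝ → ℝ) (g' l a b C : ℝ) (ha : 0 ≤ a) (hab : a < b) (haC : b ≤ C)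
    (h : HasDerivWithinAt g g' (Set.Icc 0 C) a)
    (hmin : ∀ z, a < z → z < b → g a - l * a ≤ g z - l * z) : l ≤ g' := by
  have h1 : HasDerivWithinAt g g' (Set.Ioo a b) a :=
    h.mono (fun z hz => ⟨ha.trans hz.1.le, hz.2.le.trans haC⟩)
  rw [hasDerivWithinAt_iff_tendsto_slope' (by simp)] at h1
  haveI : (𝓝[Set.Ioo a b] a).NeBot := by
    rw [← mem_closure_iff_nhdsWithin_neBot, closure_Ioo hab.ne]
    exact ⟨le_rfl, hab.le⟩
  refine ge_of_tendsto h1 ?_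
  filter_upwards [self_mem_nhdsWithin] with z hz
  rw [slope_def_field, le_div_iff₀ (by linarith [hz.1])]
  have := hmin z hz.1 hz.2
  nlinarith

lemma aux_opt (F : ℕ) (C : ℝ) (g g' : ℝ → ℝ)
    (hderiv : ∀ x ∈ Set.Icc (0 : ℝ) C, HasDerivWithinAt g (g' x) (Set.Icc 0 C) x)
    (m L : ℝ) (hm : 0 < m)
    (hincr : ∀ x₁ x₂ : ℝ, 0 ≤ x₂ → x₂ ≤ x₁ → x₁ ≤ C →
      m * (x₁ - x₂) ≤ g' x₁ - g' x₂ ∧ g' x₁ - g' x₂ ≤ L * (x₁ - x₂))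
    (lam xh : Fin F → ℝ)
    (h0 : ∀ f, 0 ≤ xh f) (hC : ∑ f, xh f ≤ C)
    (hx : ∀ x : Fin F → ℝ, (∀ f, 0 ≤ x f) → ∑ f, x f ≤ C →
        ∑ f, (g (xh f) - lam f * xh f) ≤ ∑ f, (g (x f) - lam f * x f)) :
    (∀ f, xh f = 0 ∨ m * xh f ≤ lam f - g' 0) ∧
    (∑ f, xh f < C → ∑ f, lam f ≤ F * g' 0 + L * ∑ f, xh f) := by
  have hle : ∀ f, xh f ≤ ∑ f, xh f := fun f =>
    Finset.single_le_sum (fun i _ => h0 i) (Finset.mem_univ f)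
  have key : ∀ f z, 0 ≤ z → z - xh f ≤ C - ∑ f, xh f →
      g (xh f) - lam f * xh f ≤ g z - lam f * z := by
    intro f z hz hzC
    have hs : ∀ G : Fin F → ℝ → ℝ, ∑ i, G i (Function.update xh f z i)
        = ∑ i, G i (xh i) - G f (xh f) + G f z := by
      intro G
      rw [← Finset.add_sum_erase _ _ (Finset.mem_univ f),
        ← Finset.add_sum_erase _ (fun i => G i (xh i)) (Finset.mem_univ f)]
      have : ∑ i ∈ Finset.univ.erase f, G i (Function.update xh f z i)
          = ∑ i ∈ Finset.univ.erase f, G i (xh i) :=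
        Finset.sum_congr rfl (fun i hi => by
          rw [Function.update_of_ne (Finset.ne_of_mem_erase hi)])
      rw [this, Function.update_self]
      ring
    have h1 := hx (Function.update xh f z) (fun i => by
      by_cases h : i = f
      · subst h; simpa using hz
      · rw [Function.update_of_ne h]; exact h0 i) (by
      rw [hs (fun _ x => x)]; linarith)
    rw [hs (fun i x => g x - lam i * x)] at h1
    linarith
  constructor
  · intro f
    rcases (h0 f).eq_or_lt with h | h
    · exact Or.inl h.symm
    · right
      have hfC := (hle f).trans hC
      have := aux_left g _ (lam f) (xh f) C h hfC (hderiv _ ⟨h.le, hfC⟩)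
        (fun z hz hz' => key f z hz (by linarith))
      have := (hincr (xh f) 0 le_rfl h.le hfC).1
      linarith
  · intro hlt
    have : ∀ f, lam f ≤ g' 0 + L * xh f := by
      intro f
      have hfC := (hle f).trans hC
      have := aux_right g _ (lam f) (xh f) (xh f + (C - ∑ f, xh f)) C (h0 f) (by linarith)
        (by linarith [hle f]) (hderiv _ ⟨h0 f, hfC⟩)
        (fun z hz hz' => key f z (by linarith [h0 f]) (by linarith))
      have := (hincr (xh f) 0 le_rfl (h0 f) hfC).2
      linarith
    calc ∑ f, lam f ≤ ∑ f, (g' 0 + L * xh f) := Finset.sum_le_sum (fun f _ => this f)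
      _ = _ := by simp [Finset.sum_add_distrib, Finset.mul_sum]


/-- First bound (17) of Theorem 1 with explicit constant: under the dual
ascent iteration with bounded dual iterates (Lemma 2) and nonnegative marginal
costs at zero, the averaged demand-balance violation of the anticipated flows
satisfies `|(1/T) ∑_{t=0}^{T−1} (x̂_f(t) + ŷ_f(t) − d_f(t))| ≤ Δ/(μT)`. -/
theorem averaged_constraint_violation (F : ℕ) (hF : 1 ≤ F)
    (Cc Cr : ℝ) (hCc : 0 < Cc) (hCr : 0 < Cr)
    (χ χ' φ φ' : ℝ → ℝ)
    (hχderiv : ∀ x ∈ Set.Icc (0 : ℝ) Cc, HasDerivWithinAt χ (χ' x) (Set.Icc 0 Cc) x)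
    (hφderiv : ∀ y ∈ Set.Icc (0 : ℝ) Cr, HasDerivWithinAt φ (φ' y) (Set.Icc 0 Cr) y)
    (mχ Lχ mφ Lφ : ℝ) (hmχ : 0 < mχ) (hLχ : 0 < Lχ) (hmφ : 0 < mφ) (hLφ : 0 < Lφ)
    (hχincr : ∀ x₁ x₂ : ℝ, 0 ≤ x₂ → x₂ ≤ x₁ → x₁ ≤ Cc →
      mχ * (x₁ - x₂) ≤ χ' x₁ - χ' x₂ ∧ χ' x₁ - χ' x₂ ≤ Lχ * (x₁ - x₂))
    (hφincr : ∀ y₁ y₂ : ℝ, 0 ≤ y₂ → y₂ ≤ y₁ → y₁ ≤ Cr →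
      mφ * (y₁ - y₂) ≤ φ' y₁ - φ' y₂ ∧ φ' y₁ - φ' y₂ ≤ Lφ * (y₁ - y₂))
    (hχ0 : 0 ≤ χ' 0) (hφ0 : 0 ≤ φ' 0)
    (d : ℕ → Fin F → ℝ)
    (hd_nonneg : ∀ t f, 0 ≤ d t f)
    (hd_cap : ∀ t, ∑ f, d t f ≤ Cc + Cr)
    (lam : ℕ → Fin F → ℝ) (xhat yhat : ℕ → Fin F → ℝ)
    (hx : ∀ t, (∀ f, 0 ≤ xhat t f) ∧ ∑ f, xhat t f ≤ Cc ∧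
      ∀ x : Fin F → ℝ, (∀ f, 0 ≤ x f) → ∑ f, x f ≤ Cc →
        ∑ f, (χ (xhat t f) - lam t f * xhat t f) ≤ ∑ f, (χ (x f) - lam t f * x f))
    (hy : ∀ t, (∀ f, 0 ≤ yhat t f) ∧ ∑ f, yhat t f ≤ Cr ∧
      ∀ y : Fin F → ℝ, (∀ f, 0 ≤ y f) → ∑ f, y f ≤ Cr →
        ∑ f, (φ (yhat t f) - lam t f * yhat t f) ≤ ∑ f, (φ (y f) - lam t f * y f))
    (μ : ℝ) (hμ_pos : 0 < μ) (hμ_le : μ ≤ mχ * mφ / (mχ + mφ))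
    (hupdate : ∀ t f, lam (t + 1) f = lam t f - μ * (xhat t f + yhat t f - d t f))
    (hinit_lo : ∀ f, min (χ' 0) (φ' 0) ≤ lam 0 f)
    (hinit_hi : ∑ f, lam 0 f ≤
      max Lχ Lφ * (Cc + Cr) + (F : ℝ) * max (χ' 0) (φ' 0)) :
    ∀ (f : Fin F) (T : ℕ), 1 ≤ T →
      |(1 / (T : ℝ)) * ∑ t ∈ Finset.range T, (xhat t f + yhat t f - d t f)| ≤
        (max Lχ Lφ * (Cc + Cr) + (F : ℝ) * max (χ' 0) (φ' 0)) / (μ * T) := by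
  have ox := fun t => aux_opt F Cc χ χ' hχderiv mχ Lχ hmχ hχincr (lam t) (xhat t)
    (hx t).1 (hx t).2.1 (hx t).2.2
  have oy := fun t => aux_opt F Cr φ φ' hφderiv mφ Lφ hmφ hφincr (lam t) (yhat t)
    (hy t).1 (hy t).2.1 (hy t).2.2
  have hmL1 : mχ ≤ Lχ := by
    have := hχincr Cc 0 le_rfl hCc.le le_rfl
    have h2 := this.1.trans this.2
    rw [sub_zero] at h2
    exact le_of_mul_le_mul_right h2 hCc
  have hmL2 : mφ ≤ Lφ := by
    have := hφincr Cr 0 le_rfl hCr.le le_rfl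
    have h2 := this.1.trans this.2
    rw [sub_zero] at h2
    exact le_of_mul_le_mul_right h2 hCr
  have hμ' : μ * (mχ + mφ) ≤ mχ * mφ := (le_div_iff₀ (by linarith)).1 hμ_le
  have hμ1 : μ ≤ mχ := by
    by_contra h
    push Not at h
    nlinarith [mul_pos hμ_pos hmχ]
  have hμ2 : μ ≤ mφ := by
    by_contra h
    push Not at h
    nlinarith [mul_pos hμ_pos hmφ]
  have hlo : ∀ t f, min (χ' 0) (φ' 0) ≤ lam t f := by
    intro t
    induction t with
    | zero => exact hinit_lo
    | succ t ih =>
      intro f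
      rw [hupdate]
      set s := lam t f - min (χ' 0) (φ' 0) with hs
      have hs0 : 0 ≤ s := by linarith [ih f]
      have h1 : mχ * xhat t f ≤ s := by
        rcases (ox t).1 f with h | h
        · rw [h]; linarith
        · linarith [min_le_left (χ' 0) (φ' 0)]
      have h2 : mφ * yhat t f ≤ s := by
        rcases (oy t).1 f with h | h
        · rw [h]; linarith
        · linarith [min_le_right (χ' 0) (φ' 0)]
      have h3 : mχ * mφ * (xhat t f + yhat t f) ≤ (mχ + mφ) * s := by
        nlinarith [mul_le_mul_of_nonneg_left h1 hmφ.le, mul_le_mul_of_nonneg_left h2 hmχ.le]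
      have h4 : μ * (xhat t f + yhat t f) ≤ s := by
        have h5 : 0 ≤ xhat t f + yhat t f := add_nonneg ((hx t).1 f) ((hy t).1 f)
        have h6 := mul_le_mul_of_nonneg_right hμ' h5
        have h7 : (mχ + mφ) * (μ * (xhat t f + yhat t f)) ≤ (mχ + mφ) * s := by linarith
        exact le_of_mul_le_mul_left h7 (by linarith)
      have h8 := mul_nonneg hμ_pos.le (hd_nonneg t f)
      linarith
  set Δ := max Lχ Lφ * (Cc + Cr) + (F : ℝ) * max (χ' 0) (φ' 0) with hΔ
  have hF0 : (0 : ℝ) ≤ F := Nat.cast_nonneg F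
  have hΔ1 : Lχ * (Cc + Cr) + F * χ' 0 ≤ Δ := add_le_add
    (mul_le_mul_of_nonneg_right (le_max_left _ _) (by linarith))
    (mul_le_mul_of_nonneg_left (le_max_left _ _) hF0)
  have hΔ2 : Lφ * (Cc + Cr) + F * φ' 0 ≤ Δ := add_le_add
    (mul_le_mul_of_nonneg_right (le_max_right _ _) (by linarith))
    (mul_le_mul_of_nonneg_left (le_max_right _ _) hF0)
  have hhi : ∀ t, ∑ f, lam t f ≤ Δ := by
    intro t
    induction t with
    | zero => exact hinit_hi
    | succ t ih =>
      have e : ∑ f, lam (t + 1) f = ∑ f, lam t f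
          - μ * (∑ f, xhat t f + ∑ f, yhat t f - ∑ f, d t f) := by
        simp only [hupdate, Finset.sum_sub_distrib, ← Finset.mul_sum, Finset.sum_add_distrib]
      rw [e]
      have hX0 : 0 ≤ ∑ f, xhat t f := Finset.sum_nonneg (fun f _ => (hx t).1 f)
      have hY0 : 0 ≤ ∑ f, yhat t f := Finset.sum_nonneg (fun f _ => (hy t).1 f)
      have hX := (hx t).2.1
      have hY := (hy t).2.1
      have hD := mul_le_mul_of_nonneg_left (hd_cap t) hμ_pos.le
      rcases hX.lt_or_eq with h | h
      · have h1 := (ox t).2 h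
        have h2 := mul_nonneg hμ_pos.le hY0
        have h3 := mul_le_mul_of_nonneg_left hX (by linarith : 0 ≤ Lχ - μ)
        have h4 := mul_le_mul_of_nonneg_right (hμ1.trans hmL1) hCr.le
        linarith
      rcases hY.lt_or_eq with h' | h'
      · have h1 := (oy t).2 h'
        have h2 := mul_nonneg hμ_pos.le hX0
        have h3 := mul_le_mul_of_nonneg_left hY (by linarith : 0 ≤ Lφ - μ)
        have h4 := mul_le_mul_of_nonneg_right (hμ2.trans hmL2) hCc.le
        linarith
      · rw [h, h']
        linarith
  have hpos : ∀ t f, 0 ≤ lam t f := fun t f => (le_min hχ0 hφ0).trans (hlo t f)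
  have hup : ∀ t f, lam t f ≤ Δ := fun t f =>
    (Finset.single_le_sum (fun i _ => hpos t i) (Finset.mem_univ f)).trans (hhi t)
  intro f T hT
  have tel : μ * ∑ t ∈ Finset.range T, (xhat t f + yhat t f - d t f) = lam 0 f - lam T f := by
    rw [Finset.mul_sum, ← Finset.sum_range_sub' (fun t => lam t f)]
    exact Finset.sum_congr rfl (fun t _ => by rw [hupdate]; ring)
  have hT' : (0 : ℝ) < T := by exact_mod_cast hT
  rw [le_div_iff₀ (mul_pos hμ_pos hT'), ← abs_of_pos (mul_pos hμ_pos hT'), ← abs_mul]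
  have e : 1 / (T : ℝ) * ∑ t ∈ Finset.range T, (xhat t f + yhat t f - d t f) * (μ * T)
      = lam 0 f - lam T f := by
    rw [← tel, ← Finset.sum_mul]; field_simp
  rw [mul_assoc, Finset.sum_mul, e, abs_le]
  constructor <;> linarith [hpos 0 f, hpos T f, hup 0 f, hup T f]
end

section
/- Under the setup of the dual ascent iteration (F ≥ 1; capacities C_c, C_r > 0; χ, φ differentiable with the two-sided increment bounds with constants m_χ, L_χ on [0, C_c] and m_φ, L_φ on [0, C_r]; demands d_f(t) ≥ 0 with ∑_f d_f(t) ≤ C_c + C_r; step size 0 < μ ≤ m_χ m_φ/(m_χ + m_φ); initialization λ_f(0) ≥ min{χ'(0), φ'(0)} for all f and ∑_f λ_f(0) ≤ Δ, where Δ = max{L_χ, L_φ}(C_c + C_r) + F·max{χ'(0), φ'(0)}; and additionally χ'(0) ≥ 0 and φ'(0) ≥ 0), define the time-averaged duals ν_f = (1/T) ∑_{t=1}^T λ_f(t) for a horizon T ≥ 1. Then (1/T)·√( ∑_{f=1}^F ∑_{t=1}^T 2(λ_f(t) − ν_f)² ) ≤ 2√F · Δ/√T. -/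
lemma aux_kkt (F : ℕ) (C : ℝ) (χ χ' : ℝ → ℝ)
    (hχ : ∀ x ∈ Set.Icc (0 : ℝ) C, HasDerivWithinAt χ (χ' x) (Set.Icc 0 C) x)
    (l xh : Fin F → ℝ) (h0 : ∀ f, 0 ≤ xh f) (hC : ∑ f, xh f ≤ C)
    (hmin : ∀ x : Fin F → ℝ, (∀ f, 0 ≤ x f) → ∑ f, x f ≤ C →
        ∑ f, (χ (xh f) - l f * xh f) ≤ ∑ f, (χ (x f) - l f * x f)) (f : Fin F)
    (z : ℝ) (hz0 : 0 ≤ z) (hz : z ≤ xh f + (C - ∑ f, xh f)) :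
    0 ≤ (z - xh f) * (χ' (xh f) - l f) := by
  have hle : xh f ≤ ∑ f, xh f := Finset.single_le_sum (fun i _ => h0 i) (Finset.mem_univ f)
  set b := xh f + (C - ∑ f, xh f) with hb
  have hbC : b ≤ C := by linarith
  have hmem : xh f ∈ Set.Icc 0 b := ⟨h0 f, by linarith⟩
  have hd : HasDerivWithinAt (fun z => χ z - l f * z) (χ' (xh f) - l f) (Set.Icc 0 b) (xh f) := by
    have h1 := (hχ (xh f) ⟨h0 f, hmem.2.trans hbC⟩).mono (Set.Icc_subset_Icc_right hbC)
    have h2 := (hasDerivWithinAt_id (xh f) (Set.Icc 0 b)).const_mul (l f)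
    have h3 := h1.sub h2
    rw [mul_one] at h3
    exact h3
  have hm : IsMinOn (fun z => χ z - l f * z) (Set.Icc 0 b) (xh f) := by
    intro w hw
    have h := hmin (Function.update xh f w) (by
      intro i
      by_cases hi : i = f
      · subst hi; simpa using hw.1
      · simpa [hi] using h0 i) (by
      have h2 := hw.2
      rw [Finset.sum_update_of_mem (Finset.mem_univ f)]
      have h3 := Finset.add_sum_erase Finset.univ xh (Finset.mem_univ f)
      rw [Finset.sdiff_singleton_eq_erase]
      linarith)
    rw [← Finset.add_sum_erase _ _ (Finset.mem_univ f),
      ← Finset.add_sum_erase _ (fun i => χ (Function.update xh f w i) - l i * Function.update xh f w i)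
        (Finset.mem_univ f)] at h
    have h4 : ∑ i ∈ Finset.univ.erase f,
        (χ (Function.update xh f w i) - l i * Function.update xh f w i)
        = ∑ i ∈ Finset.univ.erase f, (χ (xh i) - l i * xh i) := by
      refine Finset.sum_congr rfl fun i hi => ?_
      rw [Function.update_of_ne (Finset.ne_of_mem_erase hi)]
    rw [h4] at h
    simp only [Function.update_self] at h
    simp only [Set.mem_setOf_eq]
    linarith
  have hT : z - xh f ∈ posTangentConeAt (Set.Icc 0 b) (xh f) :=
    sub_mem_posTangentConeAt_of_segment_subset
      ((convex_Icc 0 b).segment_subset hmem ⟨hz0, hz⟩)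
  have := hm.localize.hasFDerivWithinAt_nonneg hd.hasFDerivWithinAt hT
  simpa using this

lemma aux_lo (F : ℕ) (C : ℝ) (χ χ' : ℝ → ℝ)
    (hχ : ∀ x ∈ Set.Icc (0 : ℝ) C, HasDerivWithinAt χ (χ' x) (Set.Icc 0 C) x) (m L k : ℝ)
    (hincr : ∀ x₁ x₂ : ℝ, 0 ≤ x₂ → x₂ ≤ x₁ → x₁ ≤ C →
      m * (x₁ - x₂) ≤ χ' x₁ - χ' x₂ ∧ χ' x₁ - χ' x₂ ≤ L * (x₁ - x₂)) (hk : k ≤ χ' 0)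
    (l xh : Fin F → ℝ) (hx : (∀ f, 0 ≤ xh f) ∧ ∑ f, xh f ≤ C ∧
      ∀ x : Fin F → ℝ, (∀ f, 0 ≤ x f) → ∑ f, x f ≤ C →
        ∑ f, (χ (xh f) - l f * xh f) ≤ ∑ f, (χ (x f) - l f * x f)) (f : Fin F)
    (hl : k ≤ l f) : m * xh f ≤ l f - k := by
  obtain ⟨h0, hC, hmin⟩ := hx
  have hle : xh f ≤ ∑ f, xh f := Finset.single_le_sum (fun i _ => h0 i) (Finset.mem_univ f)
  rcases (h0 f).eq_or_lt with h | h
  · rw [← h]; linarith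
  · have h1 := aux_kkt F C χ χ' hχ l xh h0 hC hmin f 0 le_rfl (by linarith [h0 f])
    have h2 := (hincr (xh f) 0 le_rfl h.le (by linarith)).1
    have h3 : χ' (xh f) ≤ l f := by
      by_contra hc
      push Not at hc
      nlinarith [mul_pos h (sub_pos.2 hc)]
    linarith

lemma aux_hi (F : ℕ) (C : ℝ) (χ χ' : ℝ → ℝ)
    (hχ : ∀ x ∈ Set.Icc (0 : ℝ) C, HasDerivWithinAt χ (χ' x) (Set.Icc 0 C) x) (m L : ℝ)
    (hincr : ∀ x₁ x₂ : ℝ, 0 ≤ x₂ → x₂ ≤ x₁ → x₁ ≤ C →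
      m * (x₁ - x₂) ≤ χ' x₁ - χ' x₂ ∧ χ' x₁ - χ' x₂ ≤ L * (x₁ - x₂))
    (l xh : Fin F → ℝ) (hx : (∀ f, 0 ≤ xh f) ∧ ∑ f, xh f ≤ C ∧
      ∀ x : Fin F → ℝ, (∀ f, 0 ≤ x f) → ∑ f, x f ≤ C →
        ∑ f, (χ (xh f) - l f * xh f) ≤ ∑ f, (χ (x f) - l f * x f))
    (hs : ∑ f, xh f < C) : ∑ f, l f ≤ F * χ' 0 + L * ∑ f, xh f := by
  obtain ⟨h0, hC, hmin⟩ := hx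
  have key : ∀ f, l f ≤ χ' 0 + L * xh f := by
    intro f
    have hle : xh f ≤ ∑ f, xh f := Finset.single_le_sum (fun i _ => h0 i) (Finset.mem_univ f)
    have h1 := aux_kkt F C χ χ' hχ l xh h0 hC hmin f (xh f + (C - ∑ f, xh f))
      (by linarith [h0 f]) le_rfl
    have h2 := (hincr (xh f) 0 le_rfl (h0 f) (by linarith)).2
    have h3 : 0 ≤ χ' (xh f) - l f := by
      refine nonneg_of_mul_nonneg_right h1 (by linarith)
    linarith
  calc ∑ f, l f ≤ ∑ f, (χ' 0 + L * xh f) := Finset.sum_le_sum fun f _ => key f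
    _ = _ := by rw [Finset.sum_add_distrib, ← Finset.mul_sum]; simp

lemma aux_final (F : ℕ) (D : ℝ) (lam : ℕ → Fin F → ℝ) (h0 : ∀ t f, 0 ≤ lam t f)
    (h1 : ∀ t f, lam t f ≤ D) (hD : 0 ≤ D) (T : ℕ) (hT : 1 ≤ T) :
    (1 / (T : ℝ)) * Real.sqrt (∑ f, ∑ t ∈ Finset.Icc 1 T,
          2 * (lam t f - (1 / (T : ℝ)) * ∑ s ∈ Finset.Icc 1 T, lam s f) ^ 2) ≤
        2 * Real.sqrt F * D / Real.sqrt T := by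
  have hTp : (0 : ℝ) < T := by exact_mod_cast hT
  have hb : ∀ f, ∀ t, (lam t f - (1 / (T : ℝ)) * ∑ s ∈ Finset.Icc 1 T, lam s f) ^ 2 ≤ D ^ 2 := by
    intro f t
    have a0 : 0 ≤ (1 / (T : ℝ)) * ∑ s ∈ Finset.Icc 1 T, lam s f :=
      mul_nonneg (by positivity) (Finset.sum_nonneg fun s _ => h0 s f)
    have a1 : (1 / (T : ℝ)) * ∑ s ∈ Finset.Icc 1 T, lam s f ≤ D := by
      have : ∑ s ∈ Finset.Icc 1 T, lam s f ≤ T * D := by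
        have := Finset.sum_le_sum (s := Finset.Icc 1 T) fun s _ => h1 s f
        simpa using this
      rw [one_div, inv_mul_le_iff₀ hTp]; exact this
    have := h0 t f
    have := h1 t f
    apply sq_le_sq'  <;> linarith
  have hsum : ∑ f, ∑ t ∈ Finset.Icc 1 T,
          2 * (lam t f - (1 / (T : ℝ)) * ∑ s ∈ Finset.Icc 1 T, lam s f) ^ 2
          ≤ (2 * Real.sqrt F * Real.sqrt T * D) ^ 2 := by
    calc _ ≤ ∑ f : Fin F, ∑ t ∈ Finset.Icc 1 T, 2 * D ^ 2 :=
          Finset.sum_le_sum fun f _ => Finset.sum_le_sum fun t _ => by linarith [hb f t]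
      _ = F * (T * (2 * D ^ 2)) := by simp
      _ ≤ _ := by
        have e1 := Real.sq_sqrt (Nat.cast_nonneg (α := ℝ) F)
        have e2 := Real.sq_sqrt hTp.le
        rw [mul_pow, mul_pow, mul_pow, e1, e2]
        have : (0 : ℝ) ≤ F * T * D ^ 2 := by positivity
        linarith
  have hs := Real.sqrt_le_sqrt hsum
  rw [Real.sqrt_sq (by positivity)] at hs
  have hsT : 0 < Real.sqrt T := Real.sqrt_pos.2 hTp
  calc _ ≤ (1 / (T : ℝ)) * (2 * Real.sqrt F * Real.sqrt T * D) :=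
        mul_le_mul_of_nonneg_left hs (by positivity)
    _ = _ := by
      have e2 := Real.mul_self_sqrt hTp.le
      rw [eq_div_iff hsT.ne', one_div, inv_mul_eq_div, div_mul_eq_mul_div, div_eq_iff hTp.ne']
      linear_combination (2 * Real.sqrt F * D) * e2

/-- Second bound (18) of Theorem 1 (single cache) with explicit constant: with
time-averaged duals `ν_f = (1/T) ∑_{t=1}^T λ_f(t)`, the norm of the Lagrangian
gradient, `(1/T)·√(∑_f ∑_{t=1}^T 2(λ_f(t) − ν_f)²)`, is at most
`2√F·Δ/√T`. -/
theorem lagrangian_gradient_bound (F : ℕ) (hF : 1 ≤ F)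
    (Cc Cr : ℝ) (hCc : 0 < Cc) (hCr : 0 < Cr)
    (χ χ' φ φ' : ℝ → ℝ)
    (hχderiv : ∀ x ∈ Set.Icc (0 : ℝ) Cc, HasDerivWithinAt χ (χ' x) (Set.Icc 0 Cc) x)
    (hφderiv : ∀ y ∈ Set.Icc (0 : ℝ) Cr, HasDerivWithinAt φ (φ' y) (Set.Icc 0 Cr) y)
    (mχ Lχ mφ Lφ : ℝ) (hmχ : 0 < mχ) (hLχ : 0 < Lχ) (hmφ : 0 < mφ) (hLφ : 0 < Lφ)
    (hχincr : ∀ x₁ x₂ : ℝ, 0 ≤ x₂ → x₂ ≤ x₁ → x₁ ≤ Cc →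
      mχ * (x₁ - x₂) ≤ χ' x₁ - χ' x₂ ∧ χ' x₁ - χ' x₂ ≤ Lχ * (x₁ - x₂))
    (hφincr : ∀ y₁ y₂ : ℝ, 0 ≤ y₂ → y₂ ≤ y₁ → y₁ ≤ Cr →
      mφ * (y₁ - y₂) ≤ φ' y₁ - φ' y₂ ∧ φ' y₁ - φ' y₂ ≤ Lφ * (y₁ - y₂))
    (hχ0 : 0 ≤ χ' 0) (hφ0 : 0 ≤ φ' 0)
    (d : ℕ → Fin F → ℝ)
    (hd_nonneg : ∀ t f, 0 ≤ d t f)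
    (hd_cap : ∀ t, ∑ f, d t f ≤ Cc + Cr)
    (lam : ℕ → Fin F → ℝ) (xhat yhat : ℕ → Fin F → ℝ)
    (hx : ∀ t, (∀ f, 0 ≤ xhat t f) ∧ ∑ f, xhat t f ≤ Cc ∧
      ∀ x : Fin F → ℝ, (∀ f, 0 ≤ x f) → ∑ f, x f ≤ Cc →
        ∑ f, (χ (xhat t f) - lam t f * xhat t f) ≤ ∑ f, (χ (x f) - lam t f * x f))
    (hy : ∀ t, (∀ f, 0 ≤ yhat t f) ∧ ∑ f, yhat t f ≤ Cr ∧
      ∀ y : Fin F → ℝ, (∀ f, 0 ≤ y f) → ∑ f, y f ≤ Cr →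
        ∑ f, (φ (yhat t f) - lam t f * yhat t f) ≤ ∑ f, (φ (y f) - lam t f * y f))
    (μ : ℝ) (hμ_pos : 0 < μ) (hμ_le : μ ≤ mχ * mφ / (mχ + mφ))
    (hupdate : ∀ t f, lam (t + 1) f = lam t f - μ * (xhat t f + yhat t f - d t f))
    (hinit_lo : ∀ f, min (χ' 0) (φ' 0) ≤ lam 0 f)
    (hinit_hi : ∑ f, lam 0 f ≤
      max Lχ Lφ * (Cc + Cr) + (F : ℝ) * max (χ' 0) (φ' 0)) :
    ∀ T : ℕ, 1 ≤ T →
      (1 / (T : ℝ)) * Real.sqrt (∑ f, ∑ t ∈ Finset.Icc 1 T,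
          2 * (lam t f - (1 / (T : ℝ)) * ∑ s ∈ Finset.Icc 1 T, lam s f) ^ 2) ≤
        2 * Real.sqrt F *
          (max Lχ Lφ * (Cc + Cr) + (F : ℝ) * max (χ' 0) (φ' 0)) / Real.sqrt T := by
  have hmu : μ * (mχ + mφ) ≤ mχ * mφ := (le_div_iff₀ (by positivity)).1 hμ_le
  have hmuχ : μ ≤ mχ := by
    have : μ * mφ ≤ mχ * mφ := by nlinarith
    exact le_of_mul_le_mul_right this hmφ
  have hmuφ : μ ≤ mφ := by
    have : μ * mχ ≤ mφ * mχ := by nlinarith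
    exact le_of_mul_le_mul_right this hmχ
  have hmLχ : mχ ≤ Lχ := by
    have h := hχincr Cc 0 le_rfl hCc.le le_rfl
    exact le_of_mul_le_mul_right (h.1.trans h.2) (by linarith)
  have hmLφ : mφ ≤ Lφ := by
    have h := hφincr Cr 0 le_rfl hCr.le le_rfl
    exact le_of_mul_le_mul_right (h.1.trans h.2) (by linarith)
  have hlo : ∀ t f, min (χ' 0) (φ' 0) ≤ lam t f := by
    intro t
    induction t with
    | zero => exact hinit_lo
    | succ t ih =>
      intro f
      have h1 := aux_lo F Cc χ χ' hχderiv mχ Lχ _ hχincr (min_le_left _ (φ' 0)) (lam t) (xhat t)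
        (hx t) f (ih f)
      have h2 := aux_lo F Cr φ φ' hφderiv mφ Lφ _ hφincr (min_le_right (χ' 0) _) (lam t) (yhat t)
        (hy t) f (ih f)
      rw [hupdate]
      have hdn := mul_nonneg hμ_pos.le (hd_nonneg t f)
      have hf := ih f
      set k := min (χ' 0) (φ' 0)
      have h3 : μ * (xhat t f + yhat t f) ≤ lam t f - k := by
        have hp : 0 < mχ * mφ := by positivity
        refine le_of_mul_le_mul_left ?_ hp
        calc mχ * mφ * (μ * (xhat t f + yhat t f))
            = μ * mφ * (mχ * xhat t f) + μ * mχ * (mφ * yhat t f) := by ring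
          _ ≤ μ * mφ * (lam t f - k) + μ * mχ * (lam t f - k) := by gcongr
          _ = (μ * (mχ + mφ)) * (lam t f - k) := by ring
          _ ≤ _ := mul_le_mul_of_nonneg_right hmu (by linarith)
      linarith
  have hnn : ∀ t f, 0 ≤ lam t f := fun t f => (le_min hχ0 hφ0).trans (hlo t f)
  have hLm1 := le_max_left Lχ Lφ
  have hLm2 := le_max_right Lχ Lφ
  have hM1 := le_max_left (χ' 0) (φ' 0)
  have hM2 := le_max_right (χ' 0) (φ' 0)
  have hFn : (0 : ℝ) ≤ F := Nat.cast_nonneg F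
  have hsum : ∀ t, ∑ f, lam t f ≤ max Lχ Lφ * (Cc + Cr) + (F : ℝ) * max (χ' 0) (φ' 0) := by
    intro t
    induction t with
    | zero => exact hinit_hi
    | succ t ih =>
      have he : ∑ f, lam (t + 1) f
          = ∑ f, lam t f - μ * (∑ f, xhat t f + ∑ f, yhat t f - ∑ f, d t f) := by
        simp only [hupdate, Finset.sum_sub_distrib, Finset.sum_add_distrib, ← Finset.mul_sum]
      have hX0 : 0 ≤ ∑ f, xhat t f := Finset.sum_nonneg fun f _ => (hx t).1 f
      have hY0 : 0 ≤ ∑ f, yhat t f := Finset.sum_nonneg fun f _ => (hy t).1 f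
      have hXC := (hx t).2.1
      have hYC := (hy t).2.1
      have hdc := hd_cap t
      have hA := aux_hi F Cc χ χ' hχderiv mχ Lχ hχincr (lam t) (xhat t) (hx t)
      have hB := aux_hi F Cr φ φ' hφderiv mφ Lφ hφincr (lam t) (yhat t) (hy t)
      rw [he]
      set L := max Lχ Lφ
      set M := max (χ' 0) (φ' 0)
      set X := ∑ f, xhat t f
      set Y := ∑ f, yhat t f
      have hLp : 0 ≤ L := by linarith
      have hmd : μ * ∑ f, d t f ≤ μ * (Cc + Cr) := by gcongr
      have hmL : μ * (Cc + Cr - X - Y) ≤ L * (Cc + Cr - X - Y) :=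
        mul_le_mul_of_nonneg_right (by linarith) (by linarith)
      have hLX := mul_nonneg hLp hX0
      have hLY := mul_nonneg hLp hY0
      rcases hXC.lt_or_eq with h | h
      · have h1 := hA h
        have h2 := mul_le_mul_of_nonneg_left hM1 hFn
        have h3 := mul_le_mul_of_nonneg_right hLm1 hX0
        linarith
      · rcases hYC.lt_or_eq with h' | h'
        · have h1 := hB h'
          have h2 := mul_le_mul_of_nonneg_left hM2 hFn
          have h3 := mul_le_mul_of_nonneg_right hLm2 hY0
          linarith
        · rw [h, h']
          linarith
  intro T hT
  refine aux_final F _ lam hnn (fun t f => ?_) ?_ T hT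
  · exact (Finset.single_le_sum (fun i _ => hnn t i) (Finset.mem_univ f)).trans (hsum t)
  · exact (Finset.sum_nonneg fun i _ => hnn 0 i).trans (hsum 0)
end
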